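/- Let μ : R → S be a crossed module of racks. Then the induced group homomorphism As(μ) : As(R) → As(S) (the unique group homomorphism with As(μ) ∘ i_R = i_S ∘ μ) and the induced action of As(S) on As(R) form a crossed module of groups: there exists a right action of As(S) on As(R) by group automorphisms satisfying i_R(r)·i_S(s) = i_R(r·s) for all r ∈ R, s ∈ S, such that As(μ) is equivariant, As(μ)(a·b) = b⁻¹ As(μ)(a) b for all a ∈ As(R), b ∈ As(S), and the Peiffer identity a·As(μ)(a') = (a')⁻¹ a a' holds for all a,a' ∈ As(R). -/

import Mathlib

/-- A right rack. -/
class RightRack (R : Type*) where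
  act : R → R → R
  act_bij : ∀ y : R, Function.Bijective (fun x => act x y)
  self_distrib : ∀ x y z : R, act (act x y) z = act (act x z) (act y z)

/-- The relations `y⁻¹ x⁻¹ y (x ◁ y)` defining the associated group of a rack. -/
def rackRels (R : Type*) [RightRack R] : Set (FreeGroup R) :=
  {w | ∃ x y : R,
    w = (FreeGroup.of y)⁻¹ * (FreeGroup.of x)⁻¹ * FreeGroup.of y *
        FreeGroup.of (RightRack.act x y)}

/-- The associated group `As(R)` of a rack `R`. -/
def AsGroup (R : Type*) [RightRack R] : Type _ := PresentedGroup (rackRels R)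

instance (R : Type*) [RightRack R] : Group (AsGroup R) :=
  inferInstanceAs (Group (PresentedGroup (rackRels R)))

/-- The canonical map `i : R → As(R)`. -/
def asOf {R : Type*} [RightRack R] (r : R) : AsGroup R :=
  PresentedGroup.of (rels := rackRels R) r

/-- A crossed module of racks `μ : R → S`: a rack morphism together with an action of
the rack `S` on the rack `R` by rack automorphisms, such that `μ` is equivariant and
the Peiffer identity holds. -/
structure RackCrossedModule (R S : Type*) [RightRack R] [RightRack S] where
  μ : R → S
  μ_hom : ∀ x y : R, μ (RightRack.act x y) = RightRack.act (μ x) (μ y)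
  smul : R → S → R
  smul_bij : ∀ s : S, Function.Bijective (fun x => smul x s)
  smul_act : ∀ (x : R) (s s' : S),
    smul (smul x s) s' = smul (smul x s') (RightRack.act s s')
  smul_aut : ∀ (x y : R) (s : S),
    smul (RightRack.act x y) s = RightRack.act (smul x s) (smul y s)
  equivar : ∀ (r : R) (s : S), μ (smul r s) = RightRack.act (μ r) s
  peiffer : ∀ r r' : R, smul r (μ r') = RightRack.act r r'

namespace AsGroup

variable {R G : Type*} [RightRack R] [Group G]

theorem asOf_act (x y : R) :
    asOf (RightRack.act x y) = (asOf y)⁻¹ * asOf x * asOf y := by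
  have h : (asOf y)⁻¹ * (asOf x)⁻¹ * asOf y * asOf (RightRack.act x y) = 1 :=
    PresentedGroup.one_of_mem (rels := rackRels R) ⟨x, y, rfl⟩
  rw [eq_inv_of_mul_eq_one_right h]
  group

/-- The universal property of the associated group. -/
def lift (f : R → G) (hf : ∀ x y, f (RightRack.act x y) = (f y)⁻¹ * f x * f y) :
    AsGroup R →* G :=
  PresentedGroup.toGroup (rels := rackRels R) (f := f) <| by
    rintro _ ⟨x, y, rfl⟩
    simp [hf, mul_assoc]

@[simp]
theorem lift_asOf (f : R → G) (hf : ∀ x y, f (RightRack.act x y) = (f y)⁻¹ * f x * f y)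
    (r : R) : lift f hf (asOf r) = f r :=
  PresentedGroup.toGroup.of (rels := rackRels R) _

theorem hom_ext {f g : AsGroup R →* G}
    (h : ∀ r : R, f (asOf r) = g (asOf r)) : f = g :=
  PresentedGroup.ext (rels := rackRels R) h

theorem closure_range_asOf : Subgroup.closure (Set.range (asOf : R → AsGroup R)) = ⊤ :=
  PresentedGroup.closure_range_of (rackRels R)

/-- The group homomorphism induced by a rack morphism. -/
def map {R' : Type*} [RightRack R'] (f : R → R')
    (hf : ∀ x y, f (RightRack.act x y) = RightRack.act (f x) (f y)) :
    AsGroup R →* AsGroup R' :=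
  lift (fun r => asOf (f r)) fun x y => by rw [hf, asOf_act]

@[simp]
theorem map_asOf {R' : Type*} [RightRack R'] (f : R → R')
    (hf : ∀ x y, f (RightRack.act x y) = RightRack.act (f x) (f y)) (r : R) :
    map f hf (asOf r) = asOf (f r) :=
  lift_asOf _ _ r

/-- The group automorphism induced by a rack automorphism. -/
def mapAut (e : R ≃ R) (he : ∀ x y, e (RightRack.act x y) = RightRack.act (e x) (e y)) :
    MulAut (AsGroup R) :=
  MonoidHom.toMulEquiv (map e he)
    (map e.symm fun x y => e.injective (by simp [he]))
    (hom_ext fun r => by simp) (hom_ext fun r => by simp)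

@[simp]
theorem mapAut_asOf (e : R ≃ R)
    (he : ∀ x y, e (RightRack.act x y) = RightRack.act (e x) (e y)) (r : R) :
    mapAut e he (asOf r) = asOf (e r) :=
  map_asOf e he r

theorem mulAut_ext {e e' : MulAut (AsGroup R)} (h : ∀ r : R, e (asOf r) = e' (asOf r)) :
    e = e' :=
  MulEquiv.toMonoidHom_injective (hom_ext h)

end AsGroup

namespace RackCrossedModule

open AsGroup

variable {R S : Type*} [RightRack R] [RightRack S] (C : RackCrossedModule R S)

/-- The automorphism of `As(R)` by which `s : S` acts on the right. -/
noncomputable def smulAut (s : S) : MulAut (AsGroup R) :=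
  mapAut (Equiv.ofBijective _ (C.smul_bij s)) fun x y => C.smul_aut x y s

@[simp]
theorem smulAut_asOf (s : S) (r : R) : C.smulAut s (asOf r) = asOf (C.smul r s) :=
  mapAut_asOf _ _ r

theorem smulAut_act (s s' : S) :
    C.smulAut (RightRack.act s s') = C.smulAut s' * C.smulAut s * (C.smulAut s')⁻¹ := by
  rw [eq_mul_inv_iff_mul_eq]
  exact mulAut_ext fun r => by simp [C.smul_act r s s']

/-- The left action of `As(S)` on `As(R)` in which `s : S` acts by the inverse of its right action. -/
noncomputable def leftAction : AsGroup S →* MulAut (AsGroup R) :=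
  lift (fun s => (C.smulAut s)⁻¹) fun s s' => by
    rw [C.smulAut_act]
    group

@[simp]
theorem leftAction_asOf (s : S) : C.leftAction (asOf s) = (C.smulAut s)⁻¹ :=
  lift_asOf _ _ s

/-- The homomorphism `As(μ)`. -/
def asMap : AsGroup R →* AsGroup S := map C.μ C.μ_hom

@[simp]
theorem asMap_asOf (r : R) : C.asMap (asOf r) = asOf (C.μ r) := map_asOf _ _ r

theorem asMap_smulAut (s : S) (a : AsGroup R) :
    C.asMap (C.smulAut s a) = (asOf s)⁻¹ * C.asMap a * asOf s := by
  have h : C.asMap.comp (C.smulAut s).toMonoidHom =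
      (MulAut.conj (asOf s)⁻¹).toMonoidHom.comp C.asMap :=
    hom_ext fun r => by simp [C.equivar, asOf_act]
  simpa using DFunLike.congr_fun h a

theorem asMap_leftAction (b : AsGroup S) (a : AsGroup R) :
    C.asMap (C.leftAction b a) = b * C.asMap a * b⁻¹ := by
  have hb : b ∈ Subgroup.closure (Set.range (asOf : S → AsGroup S)) := by
    simp [closure_range_asOf]
  induction hb using Subgroup.closure_induction generalizing a with
  | mem b hb =>
    obtain ⟨s, rfl⟩ := hb
    have h := C.asMap_smulAut s ((C.smulAut s)⁻¹ a)
    rw [MulAut.apply_inv_self] at h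
    rw [leftAction_asOf, h]
    group
  | one => simp
  | mul b b' _ _ hb hb' => simp [hb, hb', mul_assoc]
  | inv b _ hb =>
    have h := hb (C.leftAction b⁻¹ a)
    rw [← MulAut.mul_apply, ← map_mul, mul_inv_cancel, map_one, MulAut.one_apply] at h
    rw [h]
    group

theorem leftAction_asMap (a : AsGroup R) : C.leftAction (C.asMap a) = MulAut.conj a := by
  have h : C.leftAction.comp C.asMap = MulAut.conj :=
    hom_ext fun r' => by
      rw [MonoidHom.comp_apply, asMap_asOf, leftAction_asOf, inv_eq_iff_eq_inv, ← map_inv]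
      exact mulAut_ext fun r => by simp [C.peiffer, asOf_act]
  exact DFunLike.congr_fun h a

end RackCrossedModule

/-- the functor `As` sends a crossed module of racks `μ : R → S` to a
crossed module of groups `As(μ) : As(R) → As(S)`: there is a group homomorphism
`φ = As(μ)` with `φ ∘ i_R = i_S ∘ μ` and a right action `ρ` of `As(S)` on `As(R)` by
group automorphisms extending the rack action, such that `φ` is equivariant and the
Peiffer identity holds. -/
theorem asGroup_of_rackCrossedModule (R S : Type*) [RightRack R] [RightRack S]
    (C : RackCrossedModule R S) :
    ∃ (φ : AsGroup R →* AsGroup S) (ρ : AsGroup R → AsGroup S → AsGroup R),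
      (∀ r : R, φ (asOf r) = asOf (C.μ r)) ∧
      (∀ a : AsGroup R, ρ a 1 = a) ∧
      (∀ (a : AsGroup R) (b b' : AsGroup S), ρ (ρ a b) b' = ρ a (b * b')) ∧
      (∀ (a a' : AsGroup R) (b : AsGroup S), ρ (a * a') b = ρ a b * ρ a' b) ∧
      (∀ (r : R) (s : S), ρ (asOf r) (asOf s) = asOf (C.smul r s)) ∧
      (∀ (a : AsGroup R) (b : AsGroup S), φ (ρ a b) = b⁻¹ * φ a * b) ∧
      (∀ a a' : AsGroup R, ρ a (φ a') = a'⁻¹ * a * a') := by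
  refine ⟨C.asMap, fun a b => C.leftAction b⁻¹ a, C.asMap_asOf, ?_, ?_, ?_, ?_, ?_, ?_⟩
  · simp
  · simp
  · simp
  · simp
  · intro a b
    simp [C.asMap_leftAction, -map_inv]
  · intro a a'
    change C.leftAction (C.asMap a')⁻¹ a = _
    rw [← map_inv, C.leftAction_asMap]
    simp
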